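/- arXiv:1205.4590 — 2 statements merged into one kernel-verified Lean document; each statement's English description precedes it below -/
import Mathlib

section
/- Let n ≥ 3, let Γ = 0 be the flat connection coefficients on ℝⁿ, let (e₀, e₁, …, e_{n−1}) be the standard basis of ℝⁿ, let X(s) = s·e₀ (a geodesic) and ξ(s) = e₁ + s·e₂ (a generalized Jacobi field along X, since Γ = 0 and ξ̈ = 0). Define φ : ℝⁿ → ℝⁿ by φ(x) = x + (1/2)⟨x,x⟩ x, where ⟨·,·⟩ is the Euclidean inner product. Then φ restricts to a diffeomorphism of some open neighborhood V of 0 onto an open set, and, with Γ̃ the transformed connection coefficients on φ(V) and ξ̃(s) = Dφ(X(s)) ξ(s), the generalized Jacobi operator G̃ formed from Γ̃ along φ∘X satisfies G̃^μ[ξ̃](0) = −δ^μ_1; in particular ξ̃ is not a generalized Jacobi field along φ∘X. -/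
open Set ContDiff

noncomputable section

/-- The partial derivative of `f` in the `μ`-th coordinate direction at `x`. -/
def pd {n : ℕ} (μ : Fin n) (f : (Fin n → ℝ) → ℝ) (x : Fin n → ℝ) : ℝ :=
  fderiv ℝ f x (Pi.single μ 1)

/-- `Γ` is a family of smooth, torsion-free connection coefficients on `U`:
`Γ x μ ν σ` stands for `Γ^μ_{νσ}(x)`. -/
def IsConnCoeff {n : ℕ} (U : Set (Fin n → ℝ))
    (Γ : (Fin n → ℝ) → Fin n → Fin n → Fin n → ℝ) : Prop :=
  (∀ μ ν σ : Fin n, ContDiffOn ℝ ∞ (fun x => Γ x μ ν σ) U) ∧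
  (∀ x ∈ U, ∀ μ ν σ : Fin n, Γ x μ ν σ = Γ x μ σ ν)

/-- `X` is an affinely parametrized geodesic of `Γ` on the interval `I`. -/
def IsGeodesic {n : ℕ} (Γ : (Fin n → ℝ) → Fin n → Fin n → Fin n → ℝ)
    (I : Set ℝ) (X : ℝ → Fin n → ℝ) : Prop :=
  ∀ s ∈ I, ∀ μ : Fin n,
    deriv (deriv (fun t => X t μ)) s
      + ∑ ν, ∑ σ, Γ (X s) μ ν σ * deriv (fun t => X t ν) s * deriv (fun t => X t σ) s = 0

/-- The generalized Jacobi operator `G^μ[ξ](s)` along the curve `X` for the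
connection coefficients `Γ`. -/
def genJacobiOp {n : ℕ} (Γ : (Fin n → ℝ) → Fin n → Fin n → Fin n → ℝ)
    (X ξ : ℝ → Fin n → ℝ) (μ : Fin n) (s : ℝ) : ℝ :=
  deriv (deriv (fun t => ξ t μ)) s
    + (∑ ν, ∑ σ, Γ (X s) μ ν σ *
        (2 * deriv (fun t => ξ t ν) s * deriv (fun t => X t σ) s
          + deriv (fun t => ξ t ν) s * deriv (fun t => ξ t σ) s))
    + ∑ ν, ∑ σ, ∑ α, pd α (fun x => Γ x μ ν σ) (X s) * ξ s α *
        (deriv (fun t => X t ν) s + deriv (fun t => ξ t ν) s) *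
        (deriv (fun t => X t σ) s + deriv (fun t => ξ t σ) s)

/-- `ξ` is a generalized Jacobi field along `X` on the interval `I`. -/
def IsGenJacobiField {n : ℕ} (Γ : (Fin n → ℝ) → Fin n → Fin n → Fin n → ℝ)
    (I : Set ℝ) (X ξ : ℝ → Fin n → ℝ) : Prop :=
  ∀ s ∈ I, ∀ μ : Fin n, genJacobiOp Γ X ξ μ s = 0

/-- `Γt` represents the transformed connection coefficients of `Γ` under the
coordinate change `φ`:
`(∂φ^λ/∂x^α) Γ^α_{νσ} = Γt^λ_{αβ}(φ x) (∂φ^α/∂x^ν)(∂φ^β/∂x^σ) + ∂²φ^λ/∂x^ν∂x^σ` on `U`. -/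
def TransformedConn {n : ℕ} (U : Set (Fin n → ℝ)) (φ : (Fin n → ℝ) → Fin n → ℝ)
    (Γ Γt : (Fin n → ℝ) → Fin n → Fin n → Fin n → ℝ) : Prop :=
  ∀ x ∈ U, ∀ lam ν σ : Fin n,
    ∑ α, pd α (fun y => φ y lam) x * Γ x α ν σ
      = (∑ α, ∑ β, Γt (φ x) lam α β * pd ν (fun y => φ y α) x * pd σ (fun y => φ y β) x)
        + pd ν (fun y => pd σ (fun z => φ z lam) y) x

/-- `φ` is a smooth diffeomorphism from the open set `U` onto the open set `φ '' U`. -/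
def IsDiffeoOn {n : ℕ} (φ : (Fin n → ℝ) → Fin n → ℝ) (U : Set (Fin n → ℝ)) : Prop :=
  ContDiffOn ℝ ∞ φ U ∧ IsOpen (φ '' U) ∧
    ∃ ψ : (Fin n → ℝ) → Fin n → ℝ, ContDiffOn ℝ ∞ ψ (φ '' U) ∧
      (∀ x ∈ U, ψ (φ x) = x) ∧ ∀ y ∈ φ '' U, ψ y ∈ U


def nsq {n : ℕ} (x : Fin n → ℝ) : ℝ := ∑ i, x i * x i

def kd {n : ℕ} (i j : Fin n) : ℝ := if i = j then 1 else 0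

def phi {n : ℕ} (x : Fin n → ℝ) (μ : Fin n) : ℝ := x μ + (1 / 2) * (∑ i, x i * x i) * x μ

lemma nsq_nonneg {n : ℕ} (x : Fin n → ℝ) : 0 ≤ nsq x :=
  Finset.sum_nonneg fun i _ => mul_self_nonneg (x i)

lemma hasF_coord {n : ℕ} (i : Fin n) (x : Fin n → ℝ) :
    HasFDerivAt (fun y : Fin n → ℝ => y i) (ContinuousLinearMap.proj (R := ℝ) (φ := fun _ : Fin n => ℝ) i) x :=
  (ContinuousLinearMap.proj (R := ℝ) (φ := fun _ : Fin n => ℝ) i).hasFDerivAt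

lemma hasF_nsq {n : ℕ} (x : Fin n → ℝ) :
    HasFDerivAt (fun y : Fin n → ℝ => nsq y)
      (∑ i, (x i • ContinuousLinearMap.proj (R := ℝ) (φ := fun _ : Fin n => ℝ) i
        + x i • ContinuousLinearMap.proj (R := ℝ) (φ := fun _ : Fin n => ℝ) i)) x := by
  unfold nsq
  exact HasFDerivAt.fun_sum fun i _ => (hasF_coord i x).mul (hasF_coord i x)

lemma single_eq_kd {n : ℕ} (i j : Fin n) : (Pi.single i (1 : ℝ) : Fin n → ℝ) j = kd i j := by
  by_cases h : i = j
  · subst h; simp [kd]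
  · simp [kd, h]

lemma kd_comm {n : ℕ} (i j : Fin n) : kd i j = kd j i := by simp [kd, eq_comm]

lemma sum_kd {n : ℕ} (i : Fin n) (f : Fin n → ℝ) : ∑ j, f j * kd i j = f i := by simp [kd]
lemma sum_kd2 {n : ℕ} (i : Fin n) (f : Fin n → ℝ) : ∑ j, f j * kd j i = f i := by simp [kd]

lemma hasF_phi {n : ℕ} (x : Fin n → ℝ) (μ : Fin n) :
    ∃ L : (Fin n → ℝ) →L[ℝ] ℝ, HasFDerivAt (fun y => phi y μ) L x ∧
      ∀ v, L v = (1 + nsq x / 2) * v μ + (∑ i, x i * v i) * x μ := by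
  refine ⟨_, (hasF_coord μ x).add (((hasF_nsq x).const_mul (1/2)).mul (hasF_coord μ x)), ?_⟩
  intro v
  simp [Finset.sum_add_distrib]
  ring

lemma pd_phi {n : ℕ} (x : Fin n → ℝ) (μ ν : Fin n) :
    pd ν (fun y => phi y μ) x = (1 + nsq x / 2) * kd ν μ + x ν * x μ := by
  obtain ⟨L, hL, h⟩ := hasF_phi x μ
  rw [pd, hL.fderiv, h]
  simp only [single_eq_kd, sum_kd]

lemma pd_pd_phi {n : ℕ} (x : Fin n → ℝ) (l ν σ : Fin n) :
    pd ν (fun y => pd σ (fun z => phi z l) y) x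
      = kd ν σ * x l + kd ν l * x σ + kd σ l * x ν := by
  simp only [pd_phi]
  have h : HasFDerivAt (fun y : Fin n → ℝ => (1 + nsq y / 2) * kd σ l + y σ * y l) _ x :=
    ((((hasF_nsq x).mul_const (2⁻¹ : ℝ)).const_add 1).mul_const (kd σ l)).add
      ((hasF_coord σ x).mul (hasF_coord l x))
  rw [pd, h.fderiv]
  simp [Finset.sum_add_distrib, single_eq_kd, sum_kd]
  ring

def invA {n : ℕ} (x : Fin n → ℝ) (i j : Fin n) : ℝ :=
  (kd i j - x i * x j * (1 + nsq x / 2 + nsq x)⁻¹) * (1 + nsq x / 2)⁻¹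

lemma invA_spec {n : ℕ} (x : Fin n → ℝ) (i j : Fin n) :
    ∑ k, ((1 + nsq x / 2) * kd i k + x i * x k) * invA x k j = kd i j := by
  have h0 := nsq_nonneg x
  have h1 : 1 + nsq x / 2 ≠ 0 := by positivity
  have h2 : 1 + nsq x / 2 + nsq x ≠ 0 := by positivity
  have e : ∀ k, ((1 + nsq x / 2) * kd i k + x i * x k) * invA x k j
    = ((1 + nsq x / 2) * invA x k j) * kd i k
      + ((x i * x k * (1 + nsq x / 2)⁻¹) * kd k j
      - (x k * x k) * (x i * x j * (1 + nsq x / 2 + nsq x)⁻¹ * (1 + nsq x / 2)⁻¹)) := by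
    intro k; simp only [invA]; ring
  simp only [e, Finset.sum_add_distrib, Finset.sum_sub_distrib, sum_kd, sum_kd2, ← Finset.sum_mul]
  change _ + (_ - nsq x * _) = _
  simp only [invA]
  field_simp
  ring

lemma invA_symm {n : ℕ} (x : Fin n → ℝ) (i j : Fin n) : invA x i j = invA x j i := by
  simp only [invA, kd_comm i j]; ring

def hess {n : ℕ} (l ν σ : Fin n) (x : Fin n → ℝ) : ℝ :=
  kd ν σ * x l + kd ν l * x σ + kd σ l * x ν

def Cf {n : ℕ} (l ν σ : Fin n) (x : Fin n → ℝ) : ℝ :=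
  ∑ α, ∑ β, -(invA x α ν * hess l α β x * invA x β σ)

/-- Solve the transformation equation. -/
lemma solve {n : ℕ} (x : Fin n → ℝ) (l : Fin n) (g : Fin n → Fin n → ℝ)
    (h : ∀ ν σ, 0 = (∑ α, ∑ β, g α β * pd ν (fun y => phi y α) x * pd σ (fun y => phi y β) x)
        + pd ν (fun y => pd σ (fun z => phi z l) y) x) (ν σ : Fin n) :
    g ν σ = Cf l ν σ x := by
  let A : Matrix (Fin n) (Fin n) ℝ := fun i k => (1 + nsq x / 2) * kd i k + x i * x k
  let B : Matrix (Fin n) (Fin n) ℝ := fun i k => invA x i k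
  let H : Matrix (Fin n) (Fin n) ℝ := fun i k => hess l i k x
  let G : Matrix (Fin n) (Fin n) ℝ := fun i k => g i k
  have hAB : A * B = 1 := by
    ext i j
    rw [Matrix.mul_apply, Matrix.one_apply]
    exact invA_spec x i j
  have hBA : B * A = 1 := mul_eq_one_comm.mp hAB
  have hAG : A * G * A = -H := by
    ext i j
    have := h i j
    rw [pd_pd_phi] at this
    simp only [pd_phi] at this
    simp only [Matrix.mul_apply, Matrix.neg_apply, Finset.sum_mul]
    rw [Finset.sum_comm]
    have e : H i j = kd i j * x l + kd i l * x j + kd j l * x i := rfl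
    rw [e, eq_comm, neg_eq_iff_add_eq_zero, add_comm, this]
    congr 1
    refine Finset.sum_congr rfl fun a _ => Finset.sum_congr rfl fun b _ => ?_
    simp only [A, G, kd_comm j b]; ring
  have hG : G = B * (-H) * B := by
    rw [← hAG]
    calc G = (B * A) * G * (A * B) := by rw [hAB, hBA]; simp
      _ = _ := by simp only [Matrix.mul_assoc]
  have : G ν σ = (B * (-H) * B) ν σ := by rw [← hG]
  change G ν σ = _
  rw [this]
  simp only [Matrix.mul_apply, Matrix.neg_apply, Finset.sum_mul, Cf]
  rw [Finset.sum_comm]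
  refine Finset.sum_congr rfl fun a _ => Finset.sum_congr rfl fun b _ => ?_
  simp only [B, H, invA_symm x ν a]; ring

lemma hess_zero {n : ℕ} (l ν σ : Fin n) : hess l ν σ 0 = 0 := by simp [hess]

lemma Cf_zero {n : ℕ} (l ν σ : Fin n) : Cf l ν σ 0 = 0 := by simp [Cf, hess_zero]

lemma invA_zero {n : ℕ} (i j : Fin n) : invA 0 i j = kd i j := by simp [invA, nsq]

lemma diff_invA {n : ℕ} (i j : Fin n) (x : Fin n → ℝ) :
    DifferentiableAt ℝ (fun y => invA y i j) x := by
  have h0 := nsq_nonneg x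
  have h1 : 1 + nsq x / 2 ≠ 0 := by positivity
  have h2 : 1 + nsq x / 2 + nsq x ≠ 0 := by positivity
  have h3 : DifferentiableAt ℝ (fun y : Fin n → ℝ => nsq y) x := (hasF_nsq x).differentiableAt
  unfold invA
  fun_prop (disch := assumption)

lemma hasF_hess {n : ℕ} (l ν σ : Fin n) (x : Fin n → ℝ) :
    ∃ L : (Fin n → ℝ) →L[ℝ] ℝ, HasFDerivAt (hess l ν σ) L x ∧ ∀ v, L v = hess l ν σ v := by
  refine ⟨_, (((hasF_coord l x).const_mul (kd ν σ)).add ((hasF_coord σ x).const_mul (kd ν l))).add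
    ((hasF_coord ν x).const_mul (kd σ l)), ?_⟩
  intro v
  simp [hess]

lemma hasF_Cf {n : ℕ} (l ν σ : Fin n) :
    ∃ L : (Fin n → ℝ) →L[ℝ] ℝ, HasFDerivAt (Cf l ν σ) L 0 ∧ ∀ v, L v = - hess l ν σ v := by
  choose L hL hLv using fun ν σ => hasF_hess l ν σ (0 : Fin n → ℝ)
  have h : HasFDerivAt (Cf l ν σ) _ 0 :=
    HasFDerivAt.fun_sum (u := Finset.univ) fun α _ => HasFDerivAt.fun_sum (u := Finset.univ) fun β _ =>
      (((diff_invA α ν 0).hasFDerivAt.mul (hL α β)).mul (diff_invA β σ 0).hasFDerivAt).neg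
  refine ⟨_, h, fun v => ?_⟩
  simp [hess_zero, invA_zero, hLv]
  simp [kd]

lemma contDiff_phi {n : ℕ} : ContDiff ℝ ∞ (phi : (Fin n → ℝ) → Fin n → ℝ) := by
  rw [contDiff_pi]
  intro i
  unfold phi
  fun_prop

lemma equiv_phi {n : ℕ} (x : Fin n → ℝ) :
    ∃ L : (Fin n → ℝ) ≃L[ℝ] (Fin n → ℝ), HasFDerivAt phi (L : (Fin n → ℝ) →L[ℝ] (Fin n → ℝ)) x ∧
      ∀ v μ, L v μ = (1 + nsq x / 2) * v μ + (∑ i, x i * v i) * x μ := by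
  choose L hL hLv using hasF_phi x
  let M : (Fin n → ℝ) →L[ℝ] (Fin n → ℝ) := ContinuousLinearMap.pi L
  have hM : HasFDerivAt phi M x := hasFDerivAt_pi.mpr hL
  have h0 := nsq_nonneg x
  have h1 : 1 + nsq x / 2 ≠ 0 := by positivity
  have h2 : 1 + nsq x / 2 + nsq x ≠ 0 := by positivity
  have hMv : ∀ v μ, M v μ = (1 + nsq x / 2) * v μ + (∑ i, x i * v i) * x μ := fun v μ => hLv μ v
  have inj : Function.Injective (M : (Fin n → ℝ) →ₗ[ℝ] (Fin n → ℝ)) := by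
    rw [injective_iff_map_eq_zero]
    intro v hv
    have e : ∀ μ, (1 + nsq x / 2) * v μ + (∑ i, x i * v i) * x μ = 0 := fun μ => by
      rw [← hMv]; exact congrFun hv μ
    have e2 : ∑ μ, x μ * ((1 + nsq x / 2) * v μ + (∑ i, x i * v i) * x μ)
        = (1 + nsq x / 2 + nsq x) * ∑ i, x i * v i := by
      rw [add_mul (1 + nsq x / 2), Finset.mul_sum, nsq, Finset.sum_mul, ← Finset.sum_add_distrib]
      refine Finset.sum_congr rfl fun i _ => ?_
      ring
    have e3 : ∑ i, x i * v i = 0 := by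
      simp only [e, mul_zero, Finset.sum_const_zero] at e2
      exact (mul_eq_zero.mp e2.symm).resolve_left h2
    ext μ
    have := e μ
    rw [e3, zero_mul, add_zero] at this
    exact (mul_eq_zero.mp this).resolve_left h1
  refine ⟨(LinearEquiv.ofInjectiveEndo _ inj).toContinuousLinearEquiv, ?_, fun v μ => hMv v μ⟩
  convert hM using 1
  ext1 v; rfl

lemma phi_zero {n : ℕ} : phi (0 : Fin n → ℝ) = 0 := by ext; simp [phi]

lemma pd_Gt {n : ℕ} (e : OpenPartialHomeomorph (Fin n → ℝ) (Fin n → ℝ)) (he : ⇑e = phi)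
    (h0 : (0 : Fin n → ℝ) ∈ e.source) (F : (Fin n → ℝ) → ℝ) (l ν σ : Fin n)
    (hF : ∀ x ∈ e.source, F (phi x) = Cf l ν σ x) (α : Fin n) :
    pd α F 0 = -(kd ν σ * kd α l + kd ν l * kd α σ + kd σ l * kd α ν) := by
  have t0 : (0 : Fin n → ℝ) ∈ e.target := by
    have := e.map_source h0
    rwa [he, phi_zero] at this
  have s0 : e.symm 0 = 0 := by
    have := e.left_inv h0
    rwa [he, phi_zero] at this
  obtain ⟨L, hL, hLv⟩ := equiv_phi (0 : Fin n → ℝ)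
  have hs : HasFDerivAt e.symm (L.symm : (Fin n → ℝ) →L[ℝ] (Fin n → ℝ)) 0 := by
    apply e.hasFDerivAt_symm t0
    rw [s0, he]; exact hL
  obtain ⟨M, hM, hMv⟩ := hasF_Cf l ν σ
  have hM' : HasFDerivAt (Cf l ν σ) M (e.symm 0) := by rw [s0]; exact hM
  have hc := hM'.comp 0 hs
  have hF' : HasFDerivAt F (M.comp (L.symm : (Fin n → ℝ) →L[ℝ] (Fin n → ℝ))) 0 := by
    refine hc.congr_of_eventuallyEq ?_
    filter_upwards [e.open_target.mem_nhds t0] with y hy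
    have := hF _ (e.map_target hy)
    rw [← he, e.right_inv hy] at this
    exact this
  have hLs : L.symm (Pi.single α 1) = Pi.single α 1 := by
    rw [ContinuousLinearEquiv.symm_apply_eq]
    ext μ
    rw [hLv]; simp [nsq]
  rw [pd, hF'.fderiv]
  simp only [ContinuousLinearMap.comp_apply, ContinuousLinearEquiv.coe_coe, hLs, hMv, hess,
    single_eq_kd]

lemma deriv_aux (c d : ℝ) :
    deriv (fun t : ℝ => (1 + t ^ 2 / 2) * (c + t * d)) = fun t => t * (c + t * d) + (1 + t ^ 2 / 2) * d := by
  ext t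
  have h1 : HasDerivAt (fun t : ℝ => 1 + t ^ 2 / 2) (2 * t / 2) t := by
    simpa using ((hasDerivAt_pow 2 t).div_const 2).const_add 1
  have h2 : HasDerivAt (fun t : ℝ => c + t * d) d t := by
    simpa using ((hasDerivAt_id t).mul_const d).const_add c
  have h3 : HasDerivAt (fun t : ℝ => (1 + t ^ 2 / 2) * (c + t * d)) _ t := h1.mul h2
  rw [h3.deriv]; ring

lemma deriv_aux2 (c d : ℝ) :
    deriv (fun t : ℝ => t * (c + t * d) + (1 + t ^ 2 / 2) * d) 0 = c := by
  have h1 : HasDerivAt (fun t : ℝ => 1 + t ^ 2 / 2) (2 * 0 / 2) 0 := by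
    simpa using ((hasDerivAt_pow 2 (0:ℝ)).div_const 2).const_add 1
  have h2 : HasDerivAt (fun t : ℝ => c + t * d) d 0 := by
    simpa using ((hasDerivAt_id (0:ℝ)).mul_const d).const_add c
  have h3 : HasDerivAt (fun t : ℝ => t * (c + t * d) + (1 + t ^ 2 / 2) * d) _ 0 :=
    ((hasDerivAt_id (0:ℝ)).mul h2).add (h1.mul_const d)
  rw [h3.deriv]; simp

lemma deriv_aux3 (c : ℝ) :
    deriv (fun t : ℝ => t * c + (1 / 2) * (t * t) * (t * c)) 0 = c := by
  have h := hasDerivAt_id (0:ℝ)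
  have h3 : HasDerivAt (fun t : ℝ => t * c + (1 / 2) * (t * t) * (t * c)) _ 0 :=
    (h.mul_const c).add (((h.mul h).const_mul (1/2)).mul (h.mul_const c))
  rw [h3.deriv]; simp

lemma final_sum {n : ℕ} (i0 i1 i2 : Fin n) (h01 : i0 ≠ i1) (h02 : i0 ≠ i2) (h12 : i1 ≠ i2) (μ : Fin n) :
    ∑ ν, ∑ σ, ∑ α, -(kd ν σ * kd α μ + kd ν μ * kd α σ + kd σ μ * kd α ν) * kd α i1 *
      (kd ν i0 + kd ν i2) * (kd σ i0 + kd σ i2) = -(2 * kd μ i1) := by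
  have e1 : ∀ ν σ, ∑ α, -(kd ν σ * kd α μ + kd ν μ * kd α σ + kd σ μ * kd α ν) * kd α i1 *
      (kd ν i0 + kd ν i2) * (kd σ i0 + kd σ i2) =
      -(kd ν σ * kd i1 μ + kd ν μ * kd i1 σ + kd σ μ * kd i1 ν) *
      (kd ν i0 + kd ν i2) * (kd σ i0 + kd σ i2) := by
    intro ν σ
    rw [← sum_kd2 i1 (fun α => -(kd ν σ * kd α μ + kd ν μ * kd α σ + kd σ μ * kd α ν) *
      (kd ν i0 + kd ν i2) * (kd σ i0 + kd σ i2))]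
    refine Finset.sum_congr rfl fun α _ => ?_
    ring
  simp only [e1]
  simp only [mul_add, Finset.sum_add_distrib, sum_kd2]
  have e2 : ∀ (i : Fin n) (f : Fin n → Fin n → ℝ), ∑ ν, ∑ σ, f ν σ * kd ν i = ∑ σ, f i σ := by
    intro i f
    rw [Finset.sum_comm]; simp only [sum_kd2]
  simp [kd, h01, h02, h12, h01.symm, h02.symm, h12.symm, eq_comm]
  try (split_ifs <;> norm_num)

/-- The explicit counterexample: for the flat connection `Γ = 0` on `ℝⁿ`
(`n ≥ 3`), the geodesic `X s = s·e₀`, the generalized Jacobi field `ξ s = e₁ + s·e₂`, and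
the map `φ x = x + ½⟨x,x⟩x`, the map `φ` is a diffeomorphism near `0`, and the transformed
field `ξ̃ s = Dφ(X s)(ξ s)` satisfies `G̃^μ[ξ̃](0) = −δ^μ_1`; in particular `ξ̃` is not a
generalized Jacobi field along `φ ∘ X` for the transformed connection coefficients. -/
theorem explicit_counterexample_genJacobi
    {n : ℕ} (hn : 3 ≤ n)
    (i0 : Fin n) (hi0 : (i0 : ℕ) = 0) (i1 : Fin n) (hi1 : (i1 : ℕ) = 1)
    (i2 : Fin n) (hi2 : (i2 : ℕ) = 2)
    (Γ0 : (Fin n → ℝ) → Fin n → Fin n → Fin n → ℝ) (hΓ0 : Γ0 = fun _ _ _ _ => 0)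
    (X : ℝ → Fin n → ℝ) (hX : X = fun s μ => if μ = i0 then s else 0)
    (ξ : ℝ → Fin n → ℝ)
    (hξ : ξ = fun s μ => (if μ = i1 then 1 else 0) + s * (if μ = i2 then 1 else 0))
    (φ : (Fin n → ℝ) → Fin n → ℝ)
    (hφ : φ = fun x μ => x μ + (1 / 2) * (∑ i, x i * x i) * x μ) :
    IsGeodesic Γ0 Set.univ X ∧ IsGenJacobiField Γ0 Set.univ X ξ ∧
    ∃ V : Set (Fin n → ℝ), IsOpen V ∧ (0 : Fin n → ℝ) ∈ V ∧ IsDiffeoOn φ V ∧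
      ∀ Γt : (Fin n → ℝ) → Fin n → Fin n → Fin n → ℝ, TransformedConn V φ Γ0 Γt →
        (∀ μ : Fin n,
          genJacobiOp Γt (fun s => φ (X s))
              (fun s μ => ∑ ν, pd ν (fun y => φ y μ) (X s) * ξ s ν) μ 0
            = -(if μ = i1 then 1 else 0)) ∧
        ∀ J : Set ℝ, (0 : ℝ) ∈ J →
          ¬ IsGenJacobiField Γt J (fun s => φ (X s))
              (fun s μ => ∑ ν, pd ν (fun y => φ y μ) (X s) * ξ s ν) := by
  have h01 : i0 ≠ i1 := fun h => by rw [h] at hi0; omega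
  have h02 : i0 ≠ i2 := fun h => by rw [h] at hi0; omega
  have h12 : i1 ≠ i2 := fun h => by rw [h] at hi1; omega
  have hφ' : φ = phi := hφ
  have hX' : X = fun s μ => s * kd μ i0 := by
    rw [hX]; ext s μ; simp [kd]
  have hξ' : ξ = fun s μ => kd μ i1 + s * kd μ i2 := hξ
  clear hφ hX hξ
  subst hφ' hX' hξ' hΓ0
  have hd1 : ∀ c : ℝ, deriv (fun t : ℝ => t * c) = fun _ => c := fun c => by
    ext t; simp
  have hd2 : ∀ c d : ℝ, deriv (fun t : ℝ => c + t * d) = fun _ => d := fun c d => by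
    ext t; simp
  refine ⟨?_, ?_, ?_⟩
  · intro s _ μ
    simp [hd1]
  · intro s _ μ
    simp [genJacobiOp, hd2, pd]
  obtain ⟨L, hL, -⟩ := equiv_phi (0 : Fin n → ℝ)
  have hcd : ContDiffAt ℝ ∞ (phi : (Fin n → ℝ) → Fin n → ℝ) 0 := contDiff_phi.contDiffAt
  obtain ⟨e, he, h0⟩ : ∃ e : OpenPartialHomeomorph (Fin n → ℝ) (Fin n → ℝ), ⇑e = phi ∧ 0 ∈ e.source :=
    ⟨hcd.toOpenPartialHomeomorph phi hL (by simp), rfl,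
      hcd.mem_toOpenPartialHomeomorph_source hL (by simp)⟩
  have himg : phi '' e.source = e.target := by rw [← he]; exact e.image_source_eq_target
  refine ⟨e.source, e.open_source, h0, ⟨contDiff_phi.contDiffOn, ?_, e.symm, ?_, ?_, ?_⟩, ?_⟩
  · rw [himg]; exact e.open_target
  · rw [himg]
    intro y hy
    obtain ⟨L', hL', -⟩ := equiv_phi (e.symm y)
    refine (e.contDiffAt_symm hy (f₀' := L') ?_ ?_).contDiffWithinAt
    · rw [he]; exact hL'
    · rw [he]; exact contDiff_phi.contDiffAt
  · intro x hx
    rw [← he]; exact e.left_inv hx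
  · rw [himg]
    intro y hy
    exact e.map_target hy
  intro Γt hΓt
  have hG : ∀ l ν σ, ∀ x ∈ e.source, Γt (phi x) l ν σ = Cf l ν σ x := by
    intro l ν σ x hx
    refine solve x l (fun ν σ => Γt (phi x) l ν σ) (fun ν σ => ?_) ν σ
    have := hΓt x hx l ν σ
    simpa using this
  have hsq : ∀ s : ℝ, ∑ i, s * kd i i0 * (s * kd i i0) = s * s := by
    intro s; simp [kd]
  have hXt : (fun s : ℝ => phi (fun μ => s * kd μ i0))
      = fun s μ => s * kd μ i0 + (1 / 2) * (s * s) * (s * kd μ i0) := by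
    ext s μ
    simp only [phi, hsq]
  have hξt : (fun (s : ℝ) (μ : Fin n) => ∑ ν, pd ν (fun y => phi y μ) (fun μ => s * kd μ i0)
        * (kd ν i1 + s * kd ν i2))
      = fun s μ => (1 + s ^ 2 / 2) * (kd μ i1 + s * kd μ i2) := by
    ext s μ
    simp only [pd_phi, nsq, hsq]
    simp [kd, add_mul, mul_add, Finset.sum_add_distrib, h01.symm, h02.symm, h12, h12.symm, h01, h02]
    simp only [eq_comm (a := μ)]
    ring
  have main : ∀ μ : Fin n, genJacobiOp Γt (fun s : ℝ => phi (fun μ => s * kd μ i0))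
      (fun (s : ℝ) (μ : Fin n) => ∑ ν, pd ν (fun y => phi y μ) (fun μ => s * kd μ i0)
        * (kd ν i1 + s * kd ν i2)) μ 0 = -(if μ = i1 then 1 else 0) := by
    intro μ
    rw [hXt, hξt]
    have z : (fun μ : Fin n => (0:ℝ) * kd μ i0 + (1 / 2) * (0 * 0) * (0 * kd μ i0)) = 0 := by
      ext; simp
    have hz : ∀ l ν σ, Γt 0 l ν σ = 0 := by
      intro l ν σ
      have := hG l ν σ 0 h0
      rwa [phi_zero, Cf_zero] at this
    have hpd := fun ν σ α => pd_Gt e he h0 (fun x => Γt x μ ν σ) μ ν σ (hG μ ν σ) α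
    simp only [genJacobiOp, deriv_aux, deriv_aux2, deriv_aux3, z, hz, hpd]
    have fs := final_sum i0 i1 i2 h01 h02 h12 μ
    simp only [zero_mul, Finset.sum_const_zero, add_zero, zero_add, ne_eq, OfNat.ofNat_ne_zero,
      not_false_eq_true, zero_pow, zero_div, one_mul, fs]
    change kd μ i1 + -(2 * kd μ i1) = - kd μ i1
    ring
  refine ⟨main, fun J hJ hf => ?_⟩
  have h1 := hf 0 hJ i1
  rw [main i1] at h1
  simp at h1
end
end

section
/- Let Γ be smooth torsion-free connection coefficients on an open set U ⊆ ℝⁿ (n ≥ 2), let X : I → U be a geodesic, and let φ : U → Ũ be a smooth diffeomorphism onto an open set Ũ ⊆ ℝⁿ with transformed connection coefficients Γ̃. Then the linear Jacobi operator transforms tensorially: for every smooth map ξ : I → ℝⁿ and every s ∈ I, J̃^μ[ξ̃](s) = (∂φ^μ/∂x^σ)(X(s)) J^σ[ξ](s), where ξ̃(s) = Dφ(X(s)) ξ(s), J is the Jacobi operator formed from Γ along X, and J̃ is the Jacobi operator formed from Γ̃ along φ∘X. In particular, if ξ solves the Jacobi equation J^μ[ξ] = 0 along X, then ξ̃ solves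 the Jacobi equation along φ∘X with respect to Γ̃. -/
open Set ContDiff

noncomputable section

/-- The (linear) Jacobi operator `J^μ[ξ](s)` along the curve `X` for the connection
coefficients `Γ`. -/
def jacobiOp {n : ℕ} (Γ : (Fin n → ℝ) → Fin n → Fin n → Fin n → ℝ)
    (X ξ : ℝ → Fin n → ℝ) (μ : Fin n) (s : ℝ) : ℝ :=
  deriv (deriv (fun t => ξ t μ)) s
    + (∑ ν, ∑ σ, ∑ τ, pd τ (fun x => Γ x μ ν σ) (X s) * ξ s τ *
        deriv (fun t => X t ν) s * deriv (fun t => X t σ) s)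
    + 2 * ∑ ν, ∑ σ, Γ (X s) μ ν σ * deriv (fun t => X t σ) s * deriv (fun t => ξ t ν) s

/-- elementary bilinear map -/
def elT {n : ℕ} (μ ν σ : Fin n) : (Fin n → ℝ) →L[ℝ] (Fin n → ℝ) →L[ℝ] (Fin n → ℝ) :=
  (ContinuousLinearMap.proj (R := ℝ) (φ := fun _ : Fin n => ℝ) ν).smulRight
    ((ContinuousLinearMap.proj (R := ℝ) (φ := fun _ : Fin n => ℝ) σ).smulRight
      (Pi.single μ (1:ℝ) : Fin n → ℝ))

/-- the bilinear map attached to coefficients -/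
def cG {n : ℕ} (Γ : (Fin n → ℝ) → Fin n → Fin n → Fin n → ℝ) (x : Fin n → ℝ) :
    (Fin n → ℝ) →L[ℝ] (Fin n → ℝ) →L[ℝ] (Fin n → ℝ) :=
  ∑ μ, ∑ ν, ∑ σ, Γ x μ ν σ • elT μ ν σ

lemma cG_apply {n : ℕ} (Γ : (Fin n → ℝ) → Fin n → Fin n → Fin n → ℝ) (x v w : Fin n → ℝ)
    (μ : Fin n) : cG Γ x v w μ = ∑ ν, ∑ σ, Γ x μ ν σ * v ν * w σ := by
  simp only [cG, elT, _root_.sum_apply, Finset.sum_apply,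
    _root_.smul_apply, Pi.smul_apply, ContinuousLinearMap.smulRight_apply,
    ContinuousLinearMap.proj_apply, smul_eq_mul]
  rw [Finset.sum_eq_single μ]
  · simp [mul_assoc]
  · intro b _ hb
    simp [Pi.single_eq_of_ne hb.symm]
  · simp

lemma fderiv_eq_sum_pd {n : ℕ} (f : (Fin n → ℝ) → ℝ) (x u : Fin n → ℝ) :
    fderiv ℝ f x u = ∑ τ, pd τ f x * u τ := by
  conv_lhs => rw [pi_eq_sum_univ' u]
  simp only [map_sum, map_smul, pd, smul_eq_mul]
  refine Finset.sum_congr rfl fun i _ => ?_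
  rw [mul_comm]

lemma sum_smul_differentiableAt {ι E F : Type*} [Fintype ι] [NormedAddCommGroup E]
    [NormedSpace ℝ E] [NormedAddCommGroup F] [NormedSpace ℝ F] {c : E → ι → ι → ι → ℝ}
    {T : ι → ι → ι → F} {x : E} (h : ∀ μ ν σ, DifferentiableAt ℝ (fun y => c y μ ν σ) x) :
    DifferentiableAt ℝ (fun y => ∑ μ, ∑ ν, ∑ σ, c y μ ν σ • T μ ν σ) x := by
  refine DifferentiableAt.fun_sum fun μ _ => DifferentiableAt.fun_sum fun ν _ =>
    DifferentiableAt.fun_sum fun σ _ => ?_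
  exact (h μ ν σ).smul_const _

lemma hasFDerivAt_apply_two {E : Type*} [NormedAddCommGroup E] [NormedSpace ℝ E]
    {G : E → E →L[ℝ] E →L[ℝ] E} {x : E} (h : DifferentiableAt ℝ G x) (v w : E) :
    DifferentiableAt ℝ (fun y => G y v w) x ∧
      ∀ u, fderiv ℝ (fun y => G y v w) x u = fderiv ℝ G x u v w := by
  have h1 := (h.hasFDerivAt.clm_apply (hasFDerivAt_const v x)).clm_apply (hasFDerivAt_const w x)
  refine ⟨h1.differentiableAt, fun u => ?_⟩
  rw [h1.fderiv]
  simp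

lemma law_differentiableAt {E : Type*} [NormedAddCommGroup E] [NormedSpace ℝ E]
    {A : E → E →L[ℝ] E} {G H : E → E →L[ℝ] E →L[ℝ] E} {ψ : E → E} {B : E → E →L[ℝ] E} {y : E}
    (hA : DifferentiableAt ℝ A (ψ y)) (hG : DifferentiableAt ℝ G (ψ y))
    (hH : DifferentiableAt ℝ H (ψ y)) (hψ : DifferentiableAt ℝ ψ y)
    (hB : DifferentiableAt ℝ B y) (a b : E) :
    DifferentiableAt ℝ (fun z => A (ψ z) (G (ψ z) (B z a) (B z b)) - H (ψ z) (B z a) (B z b)) y := by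
  have f1 := hA.comp y hψ
  have f2 := DifferentiableAt.comp (G := E →L[ℝ] E →L[ℝ] E) y hH hψ
  have f3 := DifferentiableAt.comp (G := E →L[ℝ] E →L[ℝ] E) y hG hψ
  have f4 := fun a : E => hB.clm_apply (differentiableAt_const a)
  exact (f1.clm_apply ((f3.clm_apply (f4 a)).clm_apply (f4 b))).sub
    ((f2.clm_apply (f4 a)).clm_apply (f4 b))

lemma two_le_smooth : minSmoothness ℝ 2 ≤ (∞ : WithTop ℕ∞) := by
  rw [minSmoothness_of_isRCLikeNormedField]
  exact WithTop.coe_le_coe.2 le_top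

lemma fderiv_coord {n : ℕ} {φ : (Fin n → ℝ) → Fin n → ℝ} {x : Fin n → ℝ}
    (h : DifferentiableAt ℝ φ x) (v : Fin n → ℝ) (μ : Fin n) :
    fderiv ℝ (fun y => φ y μ) x v = fderiv ℝ φ x v μ := by
  rw [(hasFDerivAt_pi'.1 h.hasFDerivAt μ).fderiv]
  rfl

lemma cG_differentiableAt {n : ℕ} {Γ : (Fin n → ℝ) → Fin n → Fin n → Fin n → ℝ}
    {x : Fin n → ℝ} (h : ∀ μ ν σ, DifferentiableAt ℝ (fun y => Γ y μ ν σ) x) :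
    DifferentiableAt ℝ (cG Γ) x := by
  have h1 := sum_smul_differentiableAt (E := Fin n → ℝ)
    (F := (Fin n → ℝ) →L[ℝ] (Fin n → ℝ) →L[ℝ] (Fin n → ℝ)) (c := Γ) (T := elT) h
  exact h1

lemma fderiv_cG {n : ℕ} {Γ : (Fin n → ℝ) → Fin n → Fin n → Fin n → ℝ}
    {x : Fin n → ℝ} (h : ∀ μ ν σ, DifferentiableAt ℝ (fun y => Γ y μ ν σ) x)
    (u v w : Fin n → ℝ) (μ : Fin n) :
    fderiv ℝ (cG Γ) x u v w μ =
      ∑ ν, ∑ σ, ∑ τ, pd τ (fun y => Γ y μ ν σ) x * u τ * v ν * w σ := by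
  have h1 : HasFDerivAt (fun y => ∑ ν, ∑ σ, Γ y μ ν σ * v ν * w σ)
      (∑ ν, ∑ σ, w σ • v ν • fderiv ℝ (fun y => Γ y μ ν σ) x) x := by
    refine HasFDerivAt.fun_sum fun ν _ => HasFDerivAt.fun_sum fun σ _ => ?_
    exact (((h μ ν σ).hasFDerivAt.mul_const (v ν)).mul_const (w σ))
  obtain ⟨h2, h2'⟩ := hasFDerivAt_apply_two (cG_differentiableAt h) v w
  have h3 : (fun y => cG Γ y v w μ) = (fun y => ∑ ν, ∑ σ, Γ y μ ν σ * v ν * w σ) := by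
    ext y; exact cG_apply ..
  have h4 := fderiv_coord h2 u μ
  rw [h2', h3, h1.fderiv] at h4
  rw [← h4]
  simp only [_root_.sum_apply, _root_.smul_apply, smul_eq_mul, fderiv_eq_sum_pd]
  refine Finset.sum_congr rfl fun ν _ => Finset.sum_congr rfl fun σ _ => ?_
  rw [Finset.mul_sum, Finset.mul_sum]
  refine Finset.sum_congr rfl fun τ _ => ?_
  ring

lemma deriv_comp_coord {n : ℕ} {I : Set ℝ} (hI : IsOpen I) {Z : ℝ → Fin n → ℝ}
    (hZ : ContDiffOn ℝ ∞ Z I) {s : ℝ} (hs : s ∈ I) (μ : Fin n) :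
    deriv (fun t => Z t μ) s = deriv Z s μ := by
  have hd : DifferentiableAt ℝ Z s :=
    (hZ.contDiffAt (hI.mem_nhds hs)).differentiableAt (by simp)
  exact ((hasDerivAt_pi.1 hd.hasDerivAt) μ).deriv

lemma deriv_contDiffOn {n : ℕ} {I : Set ℝ} (hI : IsOpen I) {Z : ℝ → Fin n → ℝ}
    (hZ : ContDiffOn ℝ ∞ Z I) : ContDiffOn ℝ ∞ (deriv Z) I :=
  hZ.deriv_of_isOpen hI (by simp)

lemma deriv2_comp_coord {n : ℕ} {I : Set ℝ} (hI : IsOpen I) {Z : ℝ → Fin n → ℝ}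
    (hZ : ContDiffOn ℝ ∞ Z I) {s : ℝ} (hs : s ∈ I) (μ : Fin n) :
    deriv (deriv (fun t => Z t μ)) s = deriv (deriv Z) s μ := by
  rw [← deriv_comp_coord hI (deriv_contDiffOn hI hZ) hs]
  apply Filter.EventuallyEq.deriv_eq
  filter_upwards [hI.mem_nhds hs] with t ht
  exact deriv_comp_coord hI hZ ht μ

lemma jacobiOp_eq {n : ℕ} {I : Set ℝ} (hI : IsOpen I)
    {Γ : (Fin n → ℝ) → Fin n → Fin n → Fin n → ℝ} {X ξ : ℝ → Fin n → ℝ}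
    (hX : ContDiffOn ℝ ∞ X I) (hξ : ContDiffOn ℝ ∞ ξ I) {s : ℝ} (hs : s ∈ I)
    (h : ∀ μ ν σ, DifferentiableAt ℝ (fun y => Γ y μ ν σ) (X s)) (μ : Fin n) :
    jacobiOp Γ X ξ μ s = (deriv (deriv ξ) s
      + fderiv ℝ (cG Γ) (X s) (ξ s) (deriv X s) (deriv X s)
      + (2:ℝ) • cG Γ (X s) (deriv ξ s) (deriv X s)) μ := by
  simp only [jacobiOp, Pi.add_apply, Pi.smul_apply, smul_eq_mul, fderiv_cG h, cG_apply,
    deriv2_comp_coord hI hξ hs, deriv_comp_coord hI hξ hs, deriv_comp_coord hI hX hs]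
  congr 2
  refine Finset.sum_congr rfl fun ν _ => Finset.sum_congr rfl fun σ _ => ?_
  ring

/-- Abstract transformation law. -/
lemma abstract_jacobi {E : Type*} [NormedAddCommGroup E] [NormedSpace ℝ E]
    {U : Set E} (hU : IsOpen U) {G Gt : E → E →L[ℝ] E →L[ℝ] E} {φ : E → E}
    (hφ : ContDiffOn ℝ ∞ φ U) {I : Set ℝ} (hI : IsOpen I) {X ξ : ℝ → E}
    (hXU : ∀ s ∈ I, X s ∈ U) (hX : ContDiffOn ℝ ∞ X I) (hξ : ContDiffOn ℝ ∞ ξ I)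
    (hlaw : ∀ x ∈ U, ∀ v w, fderiv ℝ φ x (G x v w) =
      Gt (φ x) (fderiv ℝ φ x v) (fderiv ℝ φ x w) + fderiv ℝ (fderiv ℝ φ) x v w)
    {s : ℝ} (hs : s ∈ I)
    (hgeo : deriv (deriv X) s + G (X s) (deriv X s) (deriv X s) = 0)
    (hG : DifferentiableAt ℝ G (X s)) (hGt : DifferentiableAt ℝ Gt (φ (X s)))
    (hsymm : ∀ a b, Gt (φ (X s)) a b = Gt (φ (X s)) b a) :
    let Y : ℝ → E := fun t => φ (X t)
    let η : ℝ → E := fun t => fderiv ℝ φ (X t) (ξ t)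
    deriv (deriv η) s + fderiv ℝ Gt (Y s) (η s) (deriv Y s) (deriv Y s)
      + (2:ℝ) • Gt (Y s) (deriv η s) (deriv Y s)
    = fderiv ℝ φ (X s) (deriv (deriv ξ) s
      + fderiv ℝ G (X s) (ξ s) (deriv X s) (deriv X s)
      + (2:ℝ) • G (X s) (deriv ξ s) (deriv X s)) := by
  intro Y η
  have hφ1 : ContDiffOn ℝ ∞ (fderiv ℝ φ) U := hφ.fderiv_of_isOpen hU (by simp)
  have hφ2 : ContDiffOn ℝ ∞ (fderiv ℝ (fderiv ℝ φ)) U := hφ1.fderiv_of_isOpen hU (by simp)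
  have d0 : ∀ x ∈ U, HasFDerivAt φ (fderiv ℝ φ x) x := fun x hx =>
    ((hφ.contDiffAt (hU.mem_nhds hx)).differentiableAt (by simp)).hasFDerivAt
  have d1 : ∀ x ∈ U, HasFDerivAt (fderiv ℝ φ) (fderiv ℝ (fderiv ℝ φ) x) x := fun x hx =>
    ((hφ1.contDiffAt (hU.mem_nhds hx)).differentiableAt (by simp)).hasFDerivAt
  have d2 : ∀ x ∈ U, HasFDerivAt (fderiv ℝ (fderiv ℝ φ))
      (fderiv ℝ (fderiv ℝ (fderiv ℝ φ)) x) x := fun x hx =>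
    ((hφ2.contDiffAt (hU.mem_nhds hx)).differentiableAt (by simp)).hasFDerivAt
  have s1 : ∀ x ∈ U, ∀ a b, fderiv ℝ (fderiv ℝ φ) x a b = fderiv ℝ (fderiv ℝ φ) x b a :=
    fun x hx a b => ((hφ.contDiffAt (hU.mem_nhds hx)).isSymmSndFDerivAt
      two_le_smooth).eq a b
  have s2 : ∀ x ∈ U, ∀ a b, fderiv ℝ (fderiv ℝ (fderiv ℝ φ)) x a b
      = fderiv ℝ (fderiv ℝ (fderiv ℝ φ)) x b a :=
    fun x hx a b => ((hφ1.contDiffAt (hU.mem_nhds hx)).isSymmSndFDerivAt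
      two_le_smooth).eq a b
  have ev : ∀ {Z W : E → E} {x : E} {A B : E →L[ℝ] E}, x ∈ U → (∀ y ∈ U, Z y = W y) →
      HasFDerivAt Z A x → HasFDerivAt W B x → A = B := by
    intro Z W x A B hx h hA hB
    refine hA.unique (hB.congr_of_eventuallyEq ?_)
    filter_upwards [hU.mem_nhds hx] with y hy using h y hy
  have s3 : ∀ x ∈ U, ∀ a b c, fderiv ℝ (fderiv ℝ (fderiv ℝ φ)) x a b c
      = fderiv ℝ (fderiv ℝ (fderiv ℝ φ)) x a c b := by
    intro x hx a b c
    have h1 := ((d2 x hx).clm_apply (hasFDerivAt_const b x)).clm_apply (hasFDerivAt_const c x)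
    have h2 := ((d2 x hx).clm_apply (hasFDerivAt_const c x)).clm_apply (hasFDerivAt_const b x)
    have := congrArg (fun L => L a) (ev hx (fun y hy => s1 y hy b c) h1 h2)
    simpa using this
  have dX : ∀ t ∈ I, HasDerivAt X (deriv X t) t := fun t ht =>
    ((hX.contDiffAt (hI.mem_nhds ht)).differentiableAt (by simp)).hasDerivAt
  have dX2 : HasDerivAt (deriv X) (deriv (deriv X) s) s :=
    (((hX.deriv_of_isOpen (m := ∞) hI (by simp)).contDiffAt (hI.mem_nhds hs)).differentiableAt
      (by simp)).hasDerivAt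
  have dξ : ∀ t ∈ I, HasDerivAt ξ (deriv ξ t) t := fun t ht =>
    ((hξ.contDiffAt (hI.mem_nhds ht)).differentiableAt (by simp)).hasDerivAt
  have dξ2 : HasDerivAt (deriv ξ) (deriv (deriv ξ) s) s :=
    (((hξ.deriv_of_isOpen (m := ∞) hI (by simp)).contDiffAt (hI.mem_nhds hs)).differentiableAt
      (by simp)).hasDerivAt
  have eY : deriv Y s = fderiv ℝ φ (X s) (deriv X s) :=
    ((d0 _ (hXU s hs)).comp_hasDerivAt s (dX s hs)).deriv
  have eη : ∀ t ∈ I, deriv η t = fderiv ℝ (fderiv ℝ φ) (X t) (deriv X t) (ξ t)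
      + fderiv ℝ φ (X t) (deriv ξ t) := fun t ht =>
    (((d1 _ (hXU t ht)).comp_hasDerivAt t (dX t ht)).clm_apply (dξ t ht)).deriv
  have eη2 : deriv (deriv η) s =
      fderiv ℝ (fderiv ℝ (fderiv ℝ φ)) (X s) (deriv X s) (deriv X s) (ξ s)
      + fderiv ℝ (fderiv ℝ φ) (X s) (deriv (deriv X) s) (ξ s)
      + fderiv ℝ (fderiv ℝ φ) (X s) (deriv X s) (deriv ξ s)
      + (fderiv ℝ (fderiv ℝ φ) (X s) (deriv X s) (deriv ξ s)
      + fderiv ℝ φ (X s) (deriv (deriv ξ) s)) := by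
    have e : deriv η =ᶠ[nhds s] fun t => fderiv ℝ (fderiv ℝ φ) (X t) (deriv X t) (ξ t)
      + fderiv ℝ φ (X t) (deriv ξ t) := by
      filter_upwards [hI.mem_nhds hs] with t ht using eη t ht
    rw [e.deriv_eq]
    have h1 := ((((d2 _ (hXU s hs)).comp_hasDerivAt s (dX s hs)).clm_apply dX2).clm_apply
      (dξ s hs)).add (((d1 _ (hXU s hs)).comp_hasDerivAt s (dX s hs)).clm_apply dξ2)
    exact h1.deriv
  -- differentiate the law
  have hx := hXU s hs
  have hlaw' : fderiv ℝ (fderiv ℝ φ) (X s) (ξ s) (G (X s) (deriv X s) (deriv X s))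
      + fderiv ℝ φ (X s) (fderiv ℝ G (X s) (ξ s) (deriv X s) (deriv X s))
      = fderiv ℝ Gt (φ (X s)) (fderiv ℝ φ (X s) (ξ s)) (fderiv ℝ φ (X s) (deriv X s))
          (fderiv ℝ φ (X s) (deriv X s))
        + Gt (φ (X s)) (fderiv ℝ (fderiv ℝ φ) (X s) (ξ s) (deriv X s))
          (fderiv ℝ φ (X s) (deriv X s))
        + Gt (φ (X s)) (fderiv ℝ φ (X s) (deriv X s))
          (fderiv ℝ (fderiv ℝ φ) (X s) (ξ s) (deriv X s))
        + fderiv ℝ (fderiv ℝ (fderiv ℝ φ)) (X s) (ξ s) (deriv X s) (deriv X s) := by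
    generalize deriv X s = v
    have c := hasFDerivAt_const (𝕜 := ℝ) v (X s)
    have l := (d1 _ hx).clm_apply ((hG.hasFDerivAt.clm_apply c).clm_apply c)
    have r := (((hGt.hasFDerivAt.comp (X s) (d0 _ hx)).clm_apply
      ((d1 _ hx).clm_apply c)).clm_apply ((d1 _ hx).clm_apply c)).add
      (((d2 _ hx).clm_apply c).clm_apply c)
    have := congrArg (fun L => L (ξ s)) (ev hx (fun y hy => hlaw y hy v v) l r)
    simp at this
    rw [add_comm, this]
    abel
  have hacc : deriv (deriv X) s = - G (X s) (deriv X s) (deriv X s) :=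
    eq_neg_of_add_eq_zero_left hgeo
  have hl2 := hlaw _ hx (deriv ξ s) (deriv X s)
  rw [eη2, eY, eη s hs, hacc]
  simp only [map_add, map_smul, map_neg, _root_.add_apply,
    _root_.neg_apply, hl2, Y, η]
  have hB := eq_sub_of_add_eq' hlaw'
  rw [hB, s1 _ hx (ξ s) (G (X s) (deriv X s) (deriv X s)),
    hsymm (fderiv ℝ φ (X s) (deriv X s)), s1 _ hx (deriv ξ s), s1 _ hx (ξ s) (deriv X s),
    s2 _ hx (ξ s), s3 _ hx _ (ξ s)]
  module

lemma bilin_ext {n : ℕ} {A B : (Fin n → ℝ) →L[ℝ] (Fin n → ℝ) →L[ℝ] (Fin n → ℝ)}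
    (h : ∀ ν σ : Fin n, A (Pi.single ν 1) (Pi.single σ 1) = B (Pi.single ν 1) (Pi.single σ 1))
    (v w : Fin n → ℝ) : A v w = B v w := by
  rw [pi_eq_sum_univ' v, pi_eq_sum_univ' w]
  simp only [map_sum, map_smul, _root_.sum_apply, _root_.smul_apply, h]

lemma cG_single {n : ℕ} (Γ : (Fin n → ℝ) → Fin n → Fin n → Fin n → ℝ) (x : Fin n → ℝ)
    (μ ν σ : Fin n) : cG Γ x (Pi.single ν 1) (Pi.single σ 1) μ = Γ x μ ν σ := by
  rw [cG_apply, Finset.sum_eq_single ν, Finset.sum_eq_single σ]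
  · simp
  · intro b _ hb
    simp [hb]
  · simp
  · intro b _ hb
    simp [hb]
  · simp

lemma law_coord_free {n : ℕ} {U : Set (Fin n → ℝ)} (hU : IsOpen U)
    {φ : (Fin n → ℝ) → Fin n → ℝ} (hφ : ContDiffOn ℝ ∞ φ U)
    {Γ Γt : (Fin n → ℝ) → Fin n → Fin n → Fin n → ℝ} (hΓt : TransformedConn U φ Γ Γt)
    (x : Fin n → ℝ) (hx : x ∈ U) (v w : Fin n → ℝ) :
    fderiv ℝ φ x (cG Γ x v w) = cG Γt (φ x) (fderiv ℝ φ x v) (fderiv ℝ φ x w)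
      + fderiv ℝ (fderiv ℝ φ) x v w := by
  have hφ1 : ContDiffOn ℝ ∞ (fderiv ℝ φ) U := hφ.fderiv_of_isOpen hU (by simp)
  have d0 : ∀ x ∈ U, DifferentiableAt ℝ φ x := fun x hx =>
    ((hφ.contDiffAt (hU.mem_nhds hx)).differentiableAt (by simp))
  have d1 : ∀ x ∈ U, DifferentiableAt ℝ (fderiv ℝ φ) x := fun x hx =>
    ((hφ1.contDiffAt (hU.mem_nhds hx)).differentiableAt (by simp))
  refine bilin_ext
    (A := (ContinuousLinearMap.compL ℝ _ _ _ (fderiv ℝ φ x)).comp (cG Γ x))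
    (B := (cG Γt (φ x)).bilinearComp (fderiv ℝ φ x) (fderiv ℝ φ x)
      + fderiv ℝ (fderiv ℝ φ) x) ?_ v w
  intro ν σ
  ext lam
  have h := hΓt x hx lam ν σ
  have h2 : pd ν (fun y => pd σ (fun z => φ z lam) y) x
      = fderiv ℝ (fderiv ℝ φ) x (Pi.single ν 1) (Pi.single σ 1) lam := by
    have e : (fun y => pd σ (fun z => φ z lam) y) =ᶠ[nhds x]
        fun y => fderiv ℝ φ y (Pi.single σ 1) lam := by
      filter_upwards [hU.mem_nhds hx] with y hy using fderiv_coord (d0 y hy) _ _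
    have h3 := (d1 x hx).hasFDerivAt.clm_apply (hasFDerivAt_const (Pi.single σ (1:ℝ)) x)
    rw [pd, e.fderiv_eq, fderiv_coord h3.differentiableAt, h3.fderiv]
    simp
  rw [h2] at h
  simp only [ContinuousLinearMap.comp_apply, ContinuousLinearMap.compL_apply, _root_.add_apply,
    ContinuousLinearMap.bilinearComp_apply, Pi.add_apply]
  rw [← fderiv_coord (d0 x hx), fderiv_eq_sum_pd, cG_apply]
  simp only [cG_single, ← fderiv_coord (d0 x hx)]
  exact h

lemma jacobi_main {n : ℕ} (U : Set (Fin n → ℝ)) (hU : IsOpen U)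
    (Γ : (Fin n → ℝ) → Fin n → Fin n → Fin n → ℝ) (hΓ : IsConnCoeff U Γ)
    (I : Set ℝ) (hI : IsOpen I)
    (X : ℝ → Fin n → ℝ) (hXU : ∀ s ∈ I, X s ∈ U) (hX : ContDiffOn ℝ ∞ X I)
    (hXgeo : IsGeodesic Γ I X)
    (φ : (Fin n → ℝ) → Fin n → ℝ) (hφ : IsDiffeoOn φ U)
    (Γt : (Fin n → ℝ) → Fin n → Fin n → Fin n → ℝ)
    (hΓt : TransformedConn U φ Γ Γt) (ξ : ℝ → Fin n → ℝ) (hξ : ContDiffOn ℝ ∞ ξ I)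
    (s : ℝ) (hs : s ∈ I) (μ : Fin n) :
    jacobiOp Γt (fun t => φ (X t))
          (fun t ν => ∑ ρ, pd ρ (fun y => φ y ν) (X t) * ξ t ρ) μ s
        = ∑ σ, pd σ (fun y => φ y μ) (X s) * jacobiOp Γ X ξ σ s := by
  obtain ⟨hφs, hV, ψ, hψ, hψφ, hψU⟩ := hφ
  have hlaw := law_coord_free hU hφs hΓt
  have hφ1 : ContDiffOn ℝ ∞ (fderiv ℝ φ) U := hφs.fderiv_of_isOpen hU (by simp)
  have hφ2 : ContDiffOn ℝ ∞ (fderiv ℝ (fderiv ℝ φ)) U := hφ1.fderiv_of_isOpen hU (by simp)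
  have hψ1 : ContDiffOn ℝ ∞ (fderiv ℝ ψ) (φ '' U) := hψ.fderiv_of_isOpen hV (by simp)
  have d0 : ∀ x ∈ U, DifferentiableAt ℝ φ x := fun x hx =>
    ((hφs.contDiffAt (hU.mem_nhds hx)).differentiableAt (by simp))
  have d1 : ∀ x ∈ U, DifferentiableAt ℝ (fderiv ℝ φ) x := fun x hx =>
    ((hφ1.contDiffAt (hU.mem_nhds hx)).differentiableAt (by simp))
  have d2 : ∀ x ∈ U, DifferentiableAt ℝ (fderiv ℝ (fderiv ℝ φ)) x := fun x hx =>
    ((hφ2.contDiffAt (hU.mem_nhds hx)).differentiableAt (by simp))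
  have e0 : ∀ y ∈ φ '' U, DifferentiableAt ℝ ψ y := fun x hx =>
    ((hψ.contDiffAt (hV.mem_nhds hx)).differentiableAt (by simp))
  have e1 : ∀ y ∈ φ '' U, DifferentiableAt ℝ (fderiv ℝ ψ) y := fun x hx =>
    ((hψ1.contDiffAt (hV.mem_nhds hx)).differentiableAt (by simp))
  have hφψ : ∀ y ∈ φ '' U, φ (ψ y) = y := by
    rintro _ ⟨x, hx, rfl⟩
    rw [hψφ x hx]
  have hinv : ∀ y ∈ φ '' U, ∀ a, fderiv ℝ φ (ψ y) (fderiv ℝ ψ y a) = a := by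
    intro y hy a
    have h1 := (d0 _ (hψU y hy)).hasFDerivAt.comp y (e0 y hy).hasFDerivAt
    have h2 : φ ∘ ψ =ᶠ[nhds y] id := by
      filter_upwards [hV.mem_nhds hy] with z hz using hφψ z hz
    have h3 := h1.unique ((hasFDerivAt_id y).congr_of_eventuallyEq h2)
    simpa using congrArg (fun L => L a) h3
  have hGtV : ∀ y ∈ φ '' U, ∀ a b, cG Γt y a b =
      fderiv ℝ φ (ψ y) (cG Γ (ψ y) (fderiv ℝ ψ y a) (fderiv ℝ ψ y b))
        - fderiv ℝ (fderiv ℝ φ) (ψ y) (fderiv ℝ ψ y a) (fderiv ℝ ψ y b) := by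
    intro y hy a b
    rw [hlaw _ (hψU y hy), hinv y hy, hinv y hy, hφψ y hy]
    abel
  have hΓd : ∀ x ∈ U, ∀ μ ν σ, DifferentiableAt ℝ (fun y => Γ y μ ν σ) x := fun x hx μ ν σ =>
    ((hΓ.1 μ ν σ).contDiffAt (hU.mem_nhds hx)).differentiableAt (by simp)
  have hΓsymm : ∀ x ∈ U, ∀ a b, cG Γ x a b = cG Γ x b a := by
    intro x hx a b
    refine bilin_ext (A := cG Γ x) (B := (cG Γ x).flip) ?_ a b
    intro ν σ
    ext lam
    simp only [ContinuousLinearMap.flip_apply, cG_single]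
    exact hΓ.2 x hx _ _ _
  have hΓtsymm : ∀ y ∈ φ '' U, ∀ a b, cG Γt y a b = cG Γt y b a := by
    intro y hy a b
    rw [hGtV y hy, hGtV y hy, hΓsymm _ (hψU y hy)]
    congr 1
    exact (((hφs.contDiffAt (hU.mem_nhds (hψU y hy))).isSymmSndFDerivAt
      two_le_smooth).eq _ _)
  have hΓtd : ∀ y ∈ φ '' U, ∀ μ ν σ, DifferentiableAt ℝ (fun z => Γt z μ ν σ) y := by
    intro y hy μ ν σ
    have e : (fun z => Γt z μ ν σ) =ᶠ[nhds y] fun z =>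
        (fderiv ℝ φ (ψ z) (cG Γ (ψ z) (fderiv ℝ ψ z (Pi.single ν 1))
          (fderiv ℝ ψ z (Pi.single σ 1)))
        - fderiv ℝ (fderiv ℝ φ) (ψ z) (fderiv ℝ ψ z (Pi.single ν 1))
          (fderiv ℝ ψ z (Pi.single σ 1))) μ := by
      filter_upwards [hV.mem_nhds hy] with z hz
      rw [← hGtV z hz, cG_single]
    refine DifferentiableAt.congr_of_eventuallyEq ?_ e
    have hu := hψU y hy
    have f5 := law_differentiableAt (d1 _ hu) (cG_differentiableAt (hΓd _ hu)) (d2 _ hu)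
      (e0 y hy) (e1 y hy) (Pi.single ν 1) (Pi.single σ 1)
    exact differentiableAt_pi.1 f5 μ
  have hx := hXU s hs
  have hgeo : deriv (deriv X) s + cG Γ (X s) (deriv X s) (deriv X s) = 0 := by
    ext ν
    have := hXgeo s hs ν
    rw [Pi.add_apply, Pi.zero_apply, cG_apply, ← deriv2_comp_coord hI hX hs]
    simpa only [deriv_comp_coord hI hX hs] using this
  have key := abstract_jacobi hU hφs hI hXU hX hξ hlaw hs hgeo
    (cG_differentiableAt (hΓd _ hx)) (cG_differentiableAt (hΓtd _ ⟨_, hx, rfl⟩))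
    (hΓtsymm _ ⟨_, hx, rfl⟩)
  have hY : ContDiffOn ℝ ∞ (fun t => φ (X t)) I := hφs.comp hX hXU
  have hη : ContDiffOn ℝ ∞ (fun t => fderiv ℝ φ (X t) (ξ t)) I :=
    (hφ1.comp hX hXU).clm_apply hξ
  have heq : ∀ t ∈ I, (fun ν => ∑ ρ, pd ρ (fun y => φ y ν) (X t) * ξ t ρ)
      = fderiv ℝ φ (X t) (ξ t) := by
    intro t ht
    ext ν
    rw [← fderiv_eq_sum_pd, fderiv_coord (d0 _ (hXU t ht))]
  have hee : (fun t ν => ∑ ρ, pd ρ (fun y => φ y ν) (X t) * ξ t ρ)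
      =ᶠ[nhds s] (fun t => fderiv ℝ φ (X t) (ξ t)) := by
    filter_upwards [hI.mem_nhds hs] with t ht using heq t ht
  have hη' : ContDiffOn ℝ ∞ (fun t ν => ∑ ρ, pd ρ (fun y => φ y ν) (X t) * ξ t ρ) I :=
    hη.congr heq
  rw [jacobiOp_eq hI hY hη' hs (hΓtd _ ⟨_, hx, rfl⟩), hee.deriv.deriv_eq, hee.deriv_eq,
    heq s hs]
  simp only [jacobiOp_eq hI hX hξ hs (hΓd _ hx)]
  rw [← fderiv_eq_sum_pd, fderiv_coord (d0 _ hx)]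
  exact congrFun key μ

/-- The linear Jacobi operator transforms tensorially under any smooth
diffeomorphism: `J̃^μ[ξ̃](s) = (∂φ^μ/∂x^σ)(X s) J^σ[ξ](s)` where `ξ̃ s = Dφ(X s)(ξ s)`.
In particular, solutions of the Jacobi equation are mapped to solutions. -/
theorem jacobiOp_tensorial
    {n : ℕ} (hn : 2 ≤ n) (U : Set (Fin n → ℝ)) (hU : IsOpen U)
    (Γ : (Fin n → ℝ) → Fin n → Fin n → Fin n → ℝ) (hΓ : IsConnCoeff U Γ)
    (I : Set ℝ) (hIopen : IsOpen I) (hIint : I.OrdConnected)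
    (X : ℝ → Fin n → ℝ) (hXU : ∀ s ∈ I, X s ∈ U) (hXsm : ContDiffOn ℝ ∞ X I)
    (hXgeo : IsGeodesic Γ I X)
    (φ : (Fin n → ℝ) → Fin n → ℝ) (hφ : IsDiffeoOn φ U)
    (Γt : (Fin n → ℝ) → Fin n → Fin n → Fin n → ℝ)
    (hΓt : TransformedConn U φ Γ Γt) :
    (∀ (ξ : ℝ → Fin n → ℝ), ContDiffOn ℝ ∞ ξ I → ∀ s ∈ I, ∀ μ : Fin n,
      jacobiOp Γt (fun t => φ (X t))
          (fun t ν => ∑ ρ, pd ρ (fun y => φ y ν) (X t) * ξ t ρ) μ s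
        = ∑ σ, pd σ (fun y => φ y μ) (X s) * jacobiOp Γ X ξ σ s) ∧
    (∀ (ξ : ℝ → Fin n → ℝ), ContDiffOn ℝ ∞ ξ I →
      (∀ s ∈ I, ∀ μ : Fin n, jacobiOp Γ X ξ μ s = 0) →
      ∀ s ∈ I, ∀ μ : Fin n,
        jacobiOp Γt (fun t => φ (X t))
          (fun t ν => ∑ ρ, pd ρ (fun y => φ y ν) (X t) * ξ t ρ) μ s = 0) := by
  have H := jacobi_main U hU Γ hΓ I hIopen X hXU hXsm hXgeo φ hφ Γt hΓt
  refine ⟨H, fun ξ hξ h0 s hs μ => ?_⟩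
  rw [H ξ hξ s hs μ]
  exact Finset.sum_eq_zero fun σ _ => by rw [h0 s hs σ, mul_zero]
end
end
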